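/- X = 𝓘([0,1)) ∪ 𝓘̃((0,1]). -/

import Mathlib

open Set

noncomputable section

/-- `bpt a k = a_1 + ⋯ + a_k` (0-indexed: the sum of the first `k` entries of `a`);
these are the division points `b_k` of the interval exchange. -/
def bpt {n : ℕ} (a : Fin n → ℝ) (k : ℕ) : ℝ :=
  ∑ j ∈ Finset.univ.filter (fun j : Fin n => (j : ℕ) < k), a j

/-- The left-closed right-open interval `J_i = [b_{i-1}, b_i)` (0-indexed). -/
def Jint {n : ℕ} (a : Fin n → ℝ) (i : Fin n) : Set ℝ :=
  Set.Ico (bpt a (i : ℕ)) (bpt a ((i : ℕ) + 1))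

/-- The left-open right-closed interval `J̃_i = (b_{i-1}, b_i]` (0-indexed). -/
def Jtil {n : ℕ} (a : Fin n → ℝ) (i : Fin n) : Set ℝ :=
  Set.Ioc (bpt a (i : ℕ)) (bpt a ((i : ℕ) + 1))

/-- The permuted probability vector `a^τ`, with `a^τ_{τ(i)} = a_i`. -/
def aperm {n : ℕ} (a : Fin n → ℝ) (τ : Equiv.Perm (Fin n)) : Fin n → ℝ :=
  fun j => a (τ.symm j)

/-- The set `D = {b_1, …, b_{n-1}}` of interior division points. -/
def Dset {n : ℕ} (a : Fin n → ℝ) : Set ℝ :=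
  {x | ∃ k : ℕ, 0 < k ∧ k < n ∧ x = bpt a k}

/-- `a` is a positive probability vector. -/
def IsProbVec {n : ℕ} (a : Fin n → ℝ) : Prop :=
  (∀ i, 0 < a i) ∧ ∑ i, a i = 1

/-- `T` is the Lr `(a,τ)` interval exchange transformation: on each
`J_i = [b_{i-1}, b_i)` it is the translation `x ↦ x - b_{i-1} + b^τ_{τ(i)-1}`. -/
def IsLrIET {n : ℕ} (a : Fin n → ℝ) (τ : Equiv.Perm (Fin n)) (T : ℝ → ℝ) : Prop :=
  ∀ i : Fin n, ∀ x ∈ Jint a i, T x = x - bpt a (i : ℕ) + bpt (aperm a τ) ((τ i : ℕ))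

/-- `Tt` is the dual lR `(a,τ)` interval exchange transformation: on each
`J̃_i = (b_{i-1}, b_i]` it is the translation `x ↦ x - b_{i-1} + b^τ_{τ(i)-1}`. -/
def IslRIET {n : ℕ} (a : Fin n → ℝ) (τ : Equiv.Perm (Fin n)) (Tt : ℝ → ℝ) : Prop :=
  ∀ i : Fin n, ∀ x ∈ Jtil a i, Tt x = x - bpt a (i : ℕ) + bpt (aperm a τ) ((τ i : ℕ))

/-- The Keane Condition: `D ∩ T^k(D) = ∅` for every positive integer `k`. -/
def KeaneCond {n : ℕ} (a : Fin n → ℝ) (T : ℝ → ℝ) : Prop :=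
  ∀ k : ℕ, 0 < k → Dset a ∩ (T^[k] '' Dset a) = ∅

/-- `τ` is irreducible: `τ({1,…,j}) ≠ {1,…,j}` for `j = 1, …, n-1` (0-indexed:
no proper initial segment is invariant). -/
def IrreduciblePerm {n : ℕ} (τ : Equiv.Perm (Fin n)) : Prop :=
  ∀ j : ℕ, 0 < j → j < n →
    (fun i => τ i) '' {i : Fin n | (i : ℕ) < j} ≠ {i : Fin n | (i : ℕ) < j}

/-- `P` is the family of ℤ-iterates of `T` on `[0,1)`: `P 0 = id`,
`P (k+1) = T ∘ P k`, and each `P k` maps `[0,1)` into itself. -/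
def IsZIterLr (T : ℝ → ℝ) (P : ℤ → ℝ → ℝ) : Prop :=
  (∀ x ∈ Set.Ico (0 : ℝ) 1, P 0 x = x) ∧
  ∀ k : ℤ, ∀ x ∈ Set.Ico (0 : ℝ) 1, P k x ∈ Set.Ico (0 : ℝ) 1 ∧ P (k + 1) x = T (P k x)

/-- `Pt` is the family of ℤ-iterates of `Tt` on `(0,1]`. -/
def IsZIterlR (Tt : ℝ → ℝ) (Pt : ℤ → ℝ → ℝ) : Prop :=
  (∀ x ∈ Set.Ioc (0 : ℝ) 1, Pt 0 x = x) ∧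
  ∀ k : ℤ, ∀ x ∈ Set.Ioc (0 : ℝ) 1, Pt k x ∈ Set.Ioc (0 : ℝ) 1 ∧ Pt (k + 1) x = Tt (Pt k x)

/-- `I` is the itinerary map of `T` (with ℤ-iterates `P`):
`𝓘(x)_k = i ↔ T^k x ∈ J_i` for `x ∈ [0,1)`. -/
def IsItin {n : ℕ} (a : Fin n → ℝ) (P : ℤ → ℝ → ℝ) (I : ℝ → ℤ → Fin n) : Prop :=
  ∀ x ∈ Set.Ico (0 : ℝ) 1, ∀ k : ℤ, ∀ i : Fin n, (I x k = i ↔ P k x ∈ Jint a i)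

/-- `It` is the itinerary map of `Tt` (with ℤ-iterates `Pt`):
`𝓘̃(x)_k = i ↔ T̃^k x ∈ J̃_i` for `x ∈ (0,1]`. -/
def IsItinDual {n : ℕ} (a : Fin n → ℝ) (Pt : ℤ → ℝ → ℝ) (It : ℝ → ℤ → Fin n) : Prop :=
  ∀ x ∈ Set.Ioc (0 : ℝ) 1, ∀ k : ℤ, ∀ i : Fin n, (It x k = i ↔ Pt k x ∈ Jtil a i)

/-- `D_∞ = {0,1} ∪ ⋃_{k ∈ ℤ} T^k(D)`. -/
def Dinf {n : ℕ} (a : Fin n → ℝ) (P : ℤ → ℝ → ℝ) : Set ℝ :=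
  {0, 1} ∪ ⋃ k : ℤ, P k '' Dset a

/-- The set `R = [0,1] ∖ D_∞` of regular points. -/
def Rset {n : ℕ} (a : Fin n → ℝ) (P : ℤ → ℝ → ℝ) : Set ℝ :=
  Set.Icc 0 1 \ Dinf a P

/-- The shift `S` on `Ω = {1,…,n}^ℤ`: `S(α)_i = α_{i+1}`. -/
def shiftS {n : ℕ} (α : ℤ → Fin n) : ℤ → Fin n := fun i => α (i + 1)

/-- The `k`-th power of the shift: `(S^k α)_i = α_{i+k}`. -/
def shiftZ {n : ℕ} (k : ℤ) (α : ℤ → Fin n) : ℤ → Fin n := fun i => α (i + k)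

/-- `α, β` are positively asymptotic: `α_i = β_i` for all `i ≥ N`, some `N`. -/
def PosAsymp {n : ℕ} (α β : ℤ → Fin n) : Prop :=
  ∃ N : ℕ, ∀ i : ℤ, (N : ℤ) ≤ i → α i = β i

/-- `α, β` are negatively asymptotic: `α_i = β_i` for all `i ≤ -N`, some `N`. -/
def NegAsymp {n : ℕ} (α β : ℤ → Fin n) : Prop :=
  ∃ N : ℕ, ∀ i : ℤ, i ≤ -(N : ℤ) → α i = β i

open Filter Topology

section DivisionPoints

variable {n : ℕ} {a : Fin n → ℝ}

lemma bpt_zero : bpt a 0 = 0 := by simp [bpt]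

lemma bpt_last (ha : IsProbVec a) : bpt a n = 1 := by
  rw [← ha.2, bpt]
  congr 1
  ext j
  simp

lemma bpt_succ (i : Fin n) : bpt a ((i : ℕ) + 1) = bpt a i + a i := by
  have h : Finset.univ.filter (fun j : Fin n => (j : ℕ) < (i : ℕ) + 1) =
      insert i (Finset.univ.filter (fun j : Fin n => (j : ℕ) < (i : ℕ))) := by
    ext j
    simp only [Finset.mem_filter, Finset.mem_univ, true_and, Finset.mem_insert, Fin.ext_iff]
    omega
  rw [bpt, h, Finset.sum_insert (by simp), bpt, add_comm]

lemma bpt_mono (ha : IsProbVec a) : Monotone (bpt a) := by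
  intro k l hkl
  refine Finset.sum_le_sum_of_subset_of_nonneg ?_ fun i _ _ => (ha.1 i).le
  intro j
  simp only [Finset.mem_filter, Finset.mem_univ, true_and]
  omega

lemma IsProbVec.aperm (ha : IsProbVec a) (τ : Equiv.Perm (Fin n)) : IsProbVec (aperm a τ) :=
  ⟨fun i => ha.1 _, by rw [← ha.2]; exact Equiv.sum_comp τ.symm a⟩

lemma bpt_aperm_succ (τ : Equiv.Perm (Fin n)) (i : Fin n) :
    bpt (aperm a τ) ((τ i : ℕ) + 1) = bpt (aperm a τ) (τ i : ℕ) + a i := by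
  rw [bpt_succ, aperm, τ.symm_apply_apply]

lemma Jint_subset (ha : IsProbVec a) (i : Fin n) : Jint a i ⊆ Ico 0 1 := by
  rw [← bpt_zero (a := a), ← bpt_last ha]
  exact Ico_subset_Ico (bpt_mono ha (Nat.zero_le _)) (bpt_mono ha i.2)

lemma Jtil_subset (ha : IsProbVec a) (i : Fin n) : Jtil a i ⊆ Ioc 0 1 := by
  rw [← bpt_zero (a := a), ← bpt_last ha]
  exact Ioc_subset_Ioc (bpt_mono ha (Nat.zero_le _)) (bpt_mono ha i.2)

lemma exists_mem_Ico_succ (f : ℕ → ℝ) {x : ℝ} (h0 : f 0 ≤ x) :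
    ∀ m, x < f m → ∃ i < m, x ∈ Ico (f i) (f (i + 1))
  | 0, h => absurd h h0.not_gt
  | m + 1, h => by
    by_cases hm : x < f m
    · obtain ⟨i, hi, hx⟩ := exists_mem_Ico_succ f h0 m hm
      exact ⟨i, by omega, hx⟩
    · exact ⟨m, by omega, not_lt.1 hm, h⟩

lemma exists_mem_Ioc_succ (f : ℕ → ℝ) {x : ℝ} (h0 : f 0 < x) :
    ∀ m, x ≤ f m → ∃ i < m, x ∈ Ioc (f i) (f (i + 1))
  | 0, h => absurd h h0.not_ge
  | m + 1, h => by
    by_cases hm : x ≤ f m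
    · obtain ⟨i, hi, hx⟩ := exists_mem_Ioc_succ f h0 m hm
      exact ⟨i, by omega, hx⟩
    · exact ⟨m, by omega, not_le.1 hm, h⟩

lemma exists_mem_Jint (ha : IsProbVec a) {x : ℝ} (hx : x ∈ Ico (0 : ℝ) 1) :
    ∃ i, x ∈ Jint a i := by
  obtain ⟨i, hi, h⟩ := exists_mem_Ico_succ (bpt a) (x := x) (by rw [bpt_zero]; exact hx.1) n
    (by rw [bpt_last ha]; exact hx.2)
  exact ⟨⟨i, hi⟩, h⟩

lemma exists_mem_Jtil (ha : IsProbVec a) {x : ℝ} (hx : x ∈ Ioc (0 : ℝ) 1) :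
    ∃ i, x ∈ Jtil a i := by
  obtain ⟨i, hi, h⟩ := exists_mem_Ioc_succ (bpt a) (x := x) (by rw [bpt_zero]; exact hx.1) n
    (by rw [bpt_last ha]; exact hx.2)
  exact ⟨⟨i, hi⟩, h⟩

lemma IsLrIET.injOn (ha : IsProbVec a) {τ : Equiv.Perm (Fin n)} {T : ℝ → ℝ}
    (hT : IsLrIET a τ T) : InjOn T (Ico 0 1) := by
  intro x hx y hy hxy
  obtain ⟨i, hi⟩ := exists_mem_Jint ha hx
  obtain ⟨j, hj⟩ := exists_mem_Jint ha hy
  have key : ∀ i, ∀ x ∈ Jint a i,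
      T x ∈ Ico (bpt (aperm a τ) (τ i : ℕ)) (bpt (aperm a τ) ((τ i : ℕ) + 1)) := by
    rintro i x ⟨h1, h2⟩
    rw [bpt_succ] at h2
    rw [hT i x ⟨h1, by rwa [bpt_succ]⟩, bpt_aperm_succ]
    constructor <;> linarith
  have hij : (τ i : ℕ) = τ j := by
    by_contra hne
    exact Set.disjoint_left.1 ((bpt_mono (ha.aperm τ)).pairwise_disjoint_on_Ico_succ hne)
      (key i x hi) (hxy ▸ key j y hj)
  obtain rfl : i = j := τ.injective (Fin.ext hij)
  rw [hT i x hi, hT i y hj] at hxy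
  linarith

lemma IslRIET.injOn (ha : IsProbVec a) {τ : Equiv.Perm (Fin n)} {Tt : ℝ → ℝ}
    (hTt : IslRIET a τ Tt) : InjOn Tt (Ioc 0 1) := by
  intro x hx y hy hxy
  obtain ⟨i, hi⟩ := exists_mem_Jtil ha hx
  obtain ⟨j, hj⟩ := exists_mem_Jtil ha hy
  have key : ∀ i, ∀ x ∈ Jtil a i,
      Tt x ∈ Ioc (bpt (aperm a τ) (τ i : ℕ)) (bpt (aperm a τ) ((τ i : ℕ) + 1)) := by
    rintro i x ⟨h1, h2⟩
    rw [bpt_succ] at h2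
    rw [hTt i x ⟨h1, by rwa [bpt_succ]⟩, bpt_aperm_succ]
    constructor <;> linarith
  have hij : (τ i : ℕ) = τ j := by
    by_contra hne
    exact Set.disjoint_left.1 ((bpt_mono (ha.aperm τ)).pairwise_disjoint_on_Ioc_succ hne)
      (key i x hi) (hxy ▸ key j y hj)
  obtain rfl : i = j := τ.injective (Fin.ext hij)
  rw [hTt i x hi, hTt i y hj] at hxy
  linarith

end DivisionPoints

section Iterates

variable {S : Set ℝ} {T : ℝ → ℝ} {P : ℤ → ℝ → ℝ}

/-- The itinerary map of a piecewise translation of `S` is continuous for any family `F` of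
translation-invariant one-sided neighbourhood filters for which the pieces `J i` are open. -/
lemma tendsto_itinerary {n : ℕ} {J : Fin n → Set ℝ} {c : Fin n → ℝ} {I : ℝ → ℤ → Fin n}
    {F : ℝ → Filter ℝ}
    (hT : ∀ i, ∀ x ∈ J i, T x = x + c i) (hinj : InjOn T S)
    (hcov : ∀ x ∈ S, ∃ i, x ∈ J i) (hJS : ∀ i, J i ⊆ S)
    (hJF : ∀ i, ∀ x ∈ J i, J i ∈ F x)
    (hF : ∀ x y, Tendsto (fun z => y + (z - x)) (F x) (F y))
    (hP0 : ∀ x ∈ S, P 0 x = x)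
    (hP : ∀ k : ℤ, ∀ x ∈ S, P k x ∈ S ∧ P (k + 1) x = T (P k x))
    (hI : ∀ x ∈ S, ∀ k : ℤ, ∀ i : Fin n, (I x k = i ↔ P k x ∈ J i))
    {x : ℝ} (hx : x ∈ S) : Tendsto I (F x) (𝓝 (I x)) := by
  have hS : ∀ᶠ y in F x, y ∈ S := by
    obtain ⟨i, hi⟩ := hcov x hx
    exact mem_of_superset (hJF i x hi) (hJS i)
  have hnear : ∀ k : ℤ, ∀ i, P k x ∈ J i → ∀ᶠ y in F x, P k x + (y - x) ∈ J i :=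
    fun k i hi => hF x (P k x) (hJF i _ hi)
  have htrans : ∀ k : ℤ, ∀ᶠ y in F x, P k y = P k x + (y - x) := by
    intro k
    induction k using Int.induction_on with
    | zero =>
      filter_upwards [hS] with y hy
      rw [hP0 y hy, hP0 x hx]
      ring
    | succ k ih =>
      obtain ⟨i, hi⟩ := hcov _ (hP k x hx).1
      filter_upwards [hS, ih, hnear k i hi] with y hy hk hm
      rw [(hP k y hy).2, (hP k x hx).2, hk, hT i _ hm, hT i _ hi]
      ring
    | pred k ih =>
      obtain ⟨m, hm⟩ : ∃ m : ℤ, m = -(k : ℤ) - 1 := ⟨_, rfl⟩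
      rw [← hm]
      rw [show -(k : ℤ) = m + 1 by omega] at ih
      obtain ⟨i, hi⟩ := hcov _ (hP m x hx).1
      filter_upwards [hS, ih, hnear m i hi] with y hy hk hz
      refine hinj (hP m y hy).1 (hJS i hz) ?_
      rw [← (hP m y hy).2, hk, (hP m x hx).2, hT i _ hi, hT i _ hz]
      ring
  rw [tendsto_pi_nhds]
  intro k
  refine tendsto_nhds_of_eventually_eq ?_
  have hi := (hI x hx k _).1 rfl
  filter_upwards [hS, htrans k, hnear k _ hi] with y hy hk hz
  rw [hI y hy, hk]
  exact hz

lemma iterate_add (hinj : InjOn T S) (hP0 : ∀ x ∈ S, P 0 x = x)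
    (hP : ∀ k : ℤ, ∀ x ∈ S, P k x ∈ S ∧ P (k + 1) x = T (P k x))
    {x : ℝ} (hx : x ∈ S) (j k : ℤ) : P j (P k x) = P (j + k) x := by
  have hy := (hP k x hx).1
  induction j using Int.induction_on with
  | zero => rw [hP0 _ hy, zero_add]
  | succ j ih =>
    rw [(hP j _ hy).2, ih, ← (hP _ x hx).2]
    congr 1
    ring
  | pred j ih =>
    refine hinj (hP _ _ hy).1 (hP _ x hx).1 ?_
    rw [← (hP _ _ hy).2, ← (hP _ x hx).2, sub_add_cancel, ih]
    congr 1
    ring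

end Iterates

section Regular

variable {n : ℕ} {a : Fin n → ℝ} {τ : Equiv.Perm (Fin n)} {T Tt : ℝ → ℝ} {P Pt : ℤ → ℝ → ℝ}
  {x : ℝ}

lemma Rset_subset_Ioo : Rset a P ⊆ Ioo 0 1 := by
  rintro x ⟨⟨h0, h1⟩, hD⟩
  refine ⟨lt_of_le_of_ne h0 ?_, lt_of_le_of_ne h1 ?_⟩
  · rintro rfl
    exact hD (Or.inl (by simp))
  · rintro rfl
    exact hD (Or.inl (by simp))

lemma countable_Dinf : (Dinf a P).Countable := by
  have hD : (Dset a).Countable :=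
    (Set.countable_range (bpt a)).mono (by rintro x ⟨k, -, -, rfl⟩; exact ⟨k, rfl⟩)
  exact (Set.toFinite {0, 1}).countable.union (Set.countable_iUnion fun k => hD.image _)

lemma exists_mem_Rset_Ioo {u v : ℝ} (h0 : 0 ≤ u) (huv : u < v) (h1 : v ≤ 1) :
    ∃ y ∈ Rset a P, y ∈ Ioo u v := by
  obtain ⟨y, hy, hy'⟩ := ((countable_Dinf (a := a) (P := P)).dense_compl ℝ).inter_open_nonempty
    (Ioo u v) isOpen_Ioo (nonempty_Ioo.2 huv)
  exact ⟨y, ⟨⟨h0.trans hy.1.le, hy.2.le.trans h1⟩, hy'⟩, hy⟩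

lemma frequently_Rset_right (hx : x ∈ Ico (0 : ℝ) 1) : ∃ᶠ y in 𝓝[≥] x, y ∈ Rset a P := by
  intro h
  obtain ⟨c, hc, hsub⟩ := (mem_nhdsGE_iff_exists_Ico_subset' hx.2).1 h
  obtain ⟨y, hy, hxy⟩ := exists_mem_Rset_Ioo (a := a) (P := P) hx.1
    (lt_min hc hx.2) (min_le_right c 1)
  exact hsub ⟨hxy.1.le, hxy.2.trans_le (min_le_left _ _)⟩ hy

lemma frequently_Rset_left (hx : x ∈ Ioc (0 : ℝ) 1) : ∃ᶠ y in 𝓝[≤] x, y ∈ Rset a P := by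
  intro h
  obtain ⟨c, hc, hsub⟩ := (mem_nhdsLE_iff_exists_Ioc_subset' hx.1).1 h
  obtain ⟨y, hy, hxy⟩ := exists_mem_Rset_Ioo (a := a) (P := P) (le_max_right c 0)
    (max_lt hc hx.1) hx.2
  exact hsub ⟨(le_max_left _ _).trans_lt hxy.1, hxy.2.le⟩ hy

lemma iterate_notMem_Dset (ha : IsProbVec a) (hT : IsLrIET a τ T) (hP : IsZIterLr T P)
    (hx : x ∈ Rset a P) (k : ℤ) : P k x ∉ Dset a := by
  intro hk
  refine hx.2 (Or.inr (Set.mem_iUnion.2 ⟨-k, P k x, hk, ?_⟩))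
  have hx' := Ioo_subset_Ico_self (Rset_subset_Ioo hx)
  rw [iterate_add (hT.injOn ha) hP.1 hP.2 hx', neg_add_cancel, hP.1 x hx']

lemma left_endpoint_eq_zero {i : Fin n} (h : bpt a i ∉ Dset a) : bpt a i = 0 := by
  rcases Nat.eq_zero_or_pos (i : ℕ) with hi | hi
  · rw [hi, bpt_zero]
  · exact absurd ⟨i, hi, i.2, rfl⟩ h

lemma iterate_ne_zero (ha : IsProbVec a) (hT : IsLrIET a τ T) (hP : IsZIterLr T P)
    (hx : x ∈ Rset a P) (k : ℤ) : P k x ≠ 0 := by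
  have hx' := Ioo_subset_Ico_self (Rset_subset_Ioo hx)
  have step : ∀ m : ℤ, P (m + 1) x = 0 → P m x = 0 ∧ T 0 = 0 := by
    intro m hm
    obtain ⟨i, hi⟩ := exists_mem_Jint ha (hP.2 m x hx').1
    have hTm := (hP.2 m x hx').2
    have hD := iterate_notMem_Dset ha hT hP hx m
    have hnn : 0 ≤ bpt (aperm a τ) (τ i : ℕ) := by
      rw [← bpt_zero (a := aperm a τ)]
      exact bpt_mono (ha.aperm τ) (Nat.zero_le _)
    have hTi := hT i _ hi
    have heq : P m x = bpt a i := by linarith [hi.1]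
    have hz : P m x = 0 := by
      rw [heq] at hD ⊢
      exact left_endpoint_eq_zero hD
    exact ⟨hz, by rw [← hz, ← hTm, hm, hz]⟩
  intro hk
  have hT0 : T 0 = 0 := (step (k - 1) (by rwa [sub_add_cancel])).2
  have hall : ∀ j : ℤ, P (j + k) x = 0 := by
    intro j
    induction j using Int.induction_on with
    | zero => rwa [zero_add]
    | succ j ih => rw [show (j : ℤ) + 1 + k = j + k + 1 by ring, (hP.2 _ x hx').2, ih, hT0]
    | pred j ih =>
      refine (step _ ?_).1
      rwa [show -(j : ℤ) - 1 + k + 1 = -j + k by ring]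
  have h0 := hall (-k)
  rw [neg_add_cancel, hP.1 x hx'] at h0
  exact (Rset_subset_Ioo hx).1.ne' h0

lemma iterate_mem_Jtil (ha : IsProbVec a) (hT : IsLrIET a τ T) (hP : IsZIterLr T P)
    (hx : x ∈ Rset a P) {k : ℤ} {i : Fin n} (hi : P k x ∈ Jint a i) : P k x ∈ Jtil a i := by
  refine ⟨lt_of_le_of_ne hi.1 fun h => ?_, hi.2.le⟩
  have hD := iterate_notMem_Dset ha hT hP hx k
  have h0 := iterate_ne_zero ha hT hP hx k
  rw [← h] at hD h0
  exact h0 (left_endpoint_eq_zero hD)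

lemma iterate_eq_dual (ha : IsProbVec a) (hT : IsLrIET a τ T) (hTt : IslRIET a τ Tt)
    (hP : IsZIterLr T P) (hPt : IsZIterlR Tt Pt) (hx : x ∈ Rset a P) (k : ℤ) :
    Pt k x = P k x := by
  have hx₁ := Ioo_subset_Ico_self (Rset_subset_Ioo hx)
  have hx₂ := Ioo_subset_Ioc_self (Rset_subset_Ioo hx)
  have hTT : ∀ m : ℤ, P m x ∈ Ioc (0 : ℝ) 1 ∧ Tt (P m x) = P (m + 1) x := by
    intro m
    obtain ⟨i, hi⟩ := exists_mem_Jint ha (hP.2 m x hx₁).1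
    have hi' := iterate_mem_Jtil ha hT hP hx hi
    exact ⟨Jtil_subset ha i hi', by rw [(hP.2 m x hx₁).2, hT i _ hi, hTt i _ hi']⟩
  induction k using Int.induction_on with
  | zero => rw [hP.1 x hx₁, hPt.1 x hx₂]
  | succ k ih => rw [(hPt.2 k x hx₂).2, ih, (hTT k).2]
  | pred k ih =>
    refine hTt.injOn ha (hPt.2 _ x hx₂).1 (hTT _).1 ?_
    rw [← (hPt.2 _ x hx₂).2, (hTT _).2, sub_add_cancel, ih]

lemma itinerary_eq_dual (ha : IsProbVec a) (hT : IsLrIET a τ T) (hTt : IslRIET a τ Tt)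
    (hP : IsZIterLr T P) (hPt : IsZIterlR Tt Pt) {I It : ℝ → ℤ → Fin n}
    (hI : IsItin a P I) (hIt : IsItinDual a Pt It) (hx : x ∈ Rset a P) : It x = I x := by
  funext k
  rw [hIt x (Ioo_subset_Ioc_self (Rset_subset_Ioo hx)), iterate_eq_dual ha hT hTt hP hPt hx]
  exact iterate_mem_Jtil ha hT hP hx
    ((hI x (Ioo_subset_Ico_self (Rset_subset_Ioo hx)) k _).1 rfl)

lemma IsItin.tendsto_right (ha : IsProbVec a) (hT : IsLrIET a τ T) (hP : IsZIterLr T P)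
    {I : ℝ → ℤ → Fin n} (hI : IsItin a P I) (hx : x ∈ Ico (0 : ℝ) 1) :
    Tendsto I (𝓝[≥] x) (𝓝 (I x)) := by
  refine tendsto_itinerary (F := fun x => 𝓝[≥] x)
    (c := fun i => bpt (aperm a τ) (τ i : ℕ) - bpt a i)
    (fun i y hy => by rw [hT i y hy]; ring) (hT.injOn ha)
    (fun y hy => exists_mem_Jint ha hy) (Jint_subset ha)
    (fun i y hy => mem_of_superset (Ico_mem_nhdsGE hy.2) (Ico_subset_Ico_left hy.1))
    (fun u v => ?_) hP.1 hP.2 hI hx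
  refine tendsto_nhdsWithin_of_tendsto_nhds_of_eventually_within _ ?_ ?_
  · have hc : Continuous fun z : ℝ => v + (z - u) := by fun_prop
    simpa using (hc.tendsto u).mono_left nhdsWithin_le_nhds
  · filter_upwards [self_mem_nhdsWithin] with z hz
    have : u ≤ z := hz
    exact mem_Ici.2 (by linarith)

lemma IsItinDual.tendsto_left (ha : IsProbVec a) (hTt : IslRIET a τ Tt) (hPt : IsZIterlR Tt Pt)
    {It : ℝ → ℤ → Fin n} (hIt : IsItinDual a Pt It) (hx : x ∈ Ioc (0 : ℝ) 1) :
    Tendsto It (𝓝[≤] x) (𝓝 (It x)) := by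
  refine tendsto_itinerary (F := fun x => 𝓝[≤] x)
    (c := fun i => bpt (aperm a τ) (τ i : ℕ) - bpt a i)
    (fun i y hy => by rw [hTt i y hy]; ring) (hTt.injOn ha)
    (fun y hy => exists_mem_Jtil ha hy) (Jtil_subset ha)
    (fun i y hy => mem_of_superset (Ioc_mem_nhdsLE hy.1) (Ioc_subset_Ioc_right hy.2))
    (fun u v => ?_) hPt.1 hPt.2 hIt hx
  refine tendsto_nhdsWithin_of_tendsto_nhds_of_eventually_within _ ?_ ?_
  · have hc : Continuous fun z : ℝ => v + (z - u) := by fun_prop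
    simpa using (hc.tendsto u).mono_left nhdsWithin_le_nhds
  · filter_upwards [self_mem_nhdsWithin] with z hz
    have : z ≤ u := hz
    exact mem_Iic.2 (by linarith)

end Regular

/-- Theorem 4.2: `X = 𝓘([0,1)) ∪ 𝓘̃((0,1])`. -/
theorem stmt10 {n : ℕ} (hn : 2 ≤ n) (a : Fin n → ℝ) (ha : IsProbVec a)
    (τ : Equiv.Perm (Fin n)) (T Tt : ℝ → ℝ)
    (hT : IsLrIET a τ T) (hTt : IslRIET a τ Tt)
    (P Pt : ℤ → ℝ → ℝ) (hP : IsZIterLr T P) (hPt : IsZIterlR Tt Pt)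
    (I It : ℝ → ℤ → Fin n) (hI : IsItin a P I) (hIt : IsItinDual a Pt It) :
    closure (I '' Rset a P) = I '' Set.Ico (0 : ℝ) 1 ∪ It '' Set.Ioc (0 : ℝ) 1 := by
  have heq : ∀ y ∈ Rset a P, It y = I y := fun y hy =>
    itinerary_eq_dual ha hT hTt hP hPt hI hIt hy
  refine Subset.antisymm (fun α hα => ?_) (union_subset ?_ ?_)
  · obtain ⟨V, hVmem, hVα⟩ := mem_closure_iff_ultrafilter.1 hα
    obtain ⟨U, hUR, rfl⟩ : ∃ U : Ultrafilter ℝ, Rset a P ∈ U ∧ U.map I = V := by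
      have : ((𝓟 (Rset a P) : Filter ℝ) ⊓ comap I V).NeBot := by
        rw [inf_comm, ← Filter.map_neBot_iff I, Filter.push_pull', Filter.map_principal,
          inf_of_le_left (le_principal_iff.2 hVmem)]
        exact V.neBot
      obtain ⟨U, hU⟩ := Ultrafilter.exists_le ((𝓟 (Rset a P) : Filter ℝ) ⊓ comap I V)
      refine ⟨U, le_principal_iff.1 (hU.trans inf_le_left), ?_⟩
      exact Ultrafilter.coe_le_coe.1 (map_le_iff_le_comap.2 (hU.trans inf_le_right))
    have hUα : Tendsto I U (𝓝 α) := hVα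
    obtain ⟨x, hx, hUx⟩ := (isCompact_Icc (a := (0 : ℝ)) (b := 1)).ultrafilter_le_nhds U
      (le_principal_iff.2 (mem_of_superset hUR sdiff_subset))
    rcases U.em (fun y => x ≤ y) with h | h
    · obtain ⟨y, hyR, hy⟩ := U.nonempty_of_mem (inter_mem hUR h)
      have hx' : x ∈ Ico (0 : ℝ) 1 := ⟨hx.1, lt_of_le_of_lt hy (Rset_subset_Ioo hyR).2⟩
      have hle : (U : Filter ℝ) ≤ 𝓝[≥] x := le_inf hUx (le_principal_iff.2 h)
      exact Or.inl ⟨x, hx', tendsto_nhds_unique ((hI.tendsto_right ha hT hP hx').mono_left hle) hUα⟩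
    · obtain ⟨y, hyR, hy⟩ := U.nonempty_of_mem (inter_mem hUR h)
      have hx' : x ∈ Ioc (0 : ℝ) 1 := ⟨(Rset_subset_Ioo hyR).1.trans (not_le.1 hy), hx.2⟩
      have hle : (U : Filter ℝ) ≤ 𝓝[≤] x :=
        le_inf hUx (le_principal_iff.2 (mem_of_superset h fun z hz => (not_le.1 hz).le))
      have hIt' : Tendsto I U (𝓝 (It x)) :=
        ((hIt.tendsto_left ha hTt hPt hx').mono_left hle).congr'
          (mem_of_superset hUR heq)
      exact Or.inr ⟨x, hx', tendsto_nhds_unique hIt' hUα⟩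
  · rintro _ ⟨x, hx, rfl⟩
    exact mem_closure_of_frequently_of_tendsto
      ((frequently_Rset_right hx).mono fun y hy => mem_image_of_mem I hy)
      (hI.tendsto_right ha hT hP hx)
  · rintro _ ⟨x, hx, rfl⟩
    exact mem_closure_of_frequently_of_tendsto
      ((frequently_Rset_left hx).mono fun y hy => ⟨y, hy, (heq y hy).symm⟩)
      (hIt.tendsto_left ha hTt hPt hx)
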